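/- Let g(x) := (x+1)·log₂(x+1) − x·log₂(x) for x > 0 and g(0) := 0, where log₂ denotes the base-2 logarithm. Fix κ > 1 and n_th > 0, and for n̄ > 0 set D(n̄) := √(((κ+1)·n̄ + (κ−1)·(n_th+1) + 1)² − 4·κ·n̄·(n̄+1)) and F(n̄) := g(n̄) + g(κ·n̄ + (κ−1)·(n_th+1)) − g((D(n̄) − (κ−1)·(n̄ + n_th + 1) − 1)/2) − g((D(n̄) + (κ−1)·(n̄ + n_th + 1) − 1)/2). Then F(n̄)/n̄ tends to +∞ as n̄ tends to 0 from the right. -/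

import Mathlib

/-- `g x = (x+1) log₂ (x+1) - x log₂ x`, with `g 0 = 0` (automatic from
Mathlib's convention `Real.log 0 = 0`). -/
noncomputable def g (x : ℝ) : ℝ :=
  (x + 1) * Real.logb 2 (x + 1) - x * Real.logb 2 x

/-- The discriminant term in the entanglement-assisted capacity cost function
of the amplifier channel. -/
noncomputable def D (κ nth n : ℝ) : ℝ :=
  Real.sqrt (((κ + 1) * n + (κ - 1) * (nth + 1) + 1) ^ 2 - 4 * κ * n * (n + 1))

/-- The entanglement-assisted capacity cost function of the amplifier
channel. -/
noncomputable def F (κ nth n : ℝ) : ℝ :=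
  g n + g (κ * n + (κ - 1) * (nth + 1))
    - g ((D κ nth n - (κ - 1) * (n + nth + 1) - 1) / 2)
    - g ((D κ nth n + (κ - 1) * (n + nth + 1) - 1) / 2)

open Filter Topology in
theorem HasDerivAt.tendsto_div_of_apply_zero {f : ℝ → ℝ} {f' : ℝ} (hf : HasDerivAt f f' 0)
    (h0 : f 0 = 0) : Tendsto (fun x => f x / x) (𝓝[>] 0) (𝓝 f') := by
  refine ((hasDerivAt_iff_tendsto_slope.1 hf).mono_left
    (nhdsWithin_mono 0 fun x hx => (Set.mem_Ioi.1 hx).ne')).congr fun x => ?_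
  simp [slope_def_field, h0]

theorem DifferentiableAt.mul_logb_self {f : ℝ → ℝ} {x : ℝ} (hf : DifferentiableAt ℝ f x)
    (hx : f x ≠ 0) : DifferentiableAt ℝ (fun y => f y * Real.logb 2 (f y)) x :=
  hf.mul ((hf.log hx).div_const _)

theorem differentiableAt_g {x : ℝ} (hx : 0 < x) : DifferentiableAt ℝ g x :=
  ((differentiableAt_id.add_const 1).mul_logb_self (by simp; positivity)).sub
    (differentiableAt_id.mul_logb_self hx.ne')

theorem D_zero {κ nth : ℝ} (hκ : 1 < κ) (hnth : 0 < nth) :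
    D κ nth 0 = (κ - 1) * (nth + 1) + 1 := by
  have hc : 0 < (κ - 1) * (nth + 1) := mul_pos (by linarith) (by linarith)
  rw [D, ← Real.sqrt_sq (by linarith : 0 ≤ (κ - 1) * (nth + 1) + 1)]
  congr 1
  ring

theorem hasDerivAt_D_zero {κ nth : ℝ} (hκ : 1 < κ) (hnth : 0 < nth) :
    HasDerivAt (D κ nth) (κ + 1 - 2 * κ / ((κ - 1) * (nth + 1) + 1)) 0 := by
  have hc : 0 < (κ - 1) * (nth + 1) := mul_pos (by linarith) (by linarith)
  have hpoly : HasDerivAt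
      (fun n => ((κ + 1) * n + (κ - 1) * (nth + 1) + 1) ^ 2 - 4 * κ * n * (n + 1))
      (2 * (κ + 1) * ((κ - 1) * (nth + 1) + 1) - 4 * κ) 0 := by
    have h1 := (((((hasDerivAt_id (0 : ℝ)).const_mul (κ + 1)).add_const
      ((κ - 1) * (nth + 1))).add_const 1).pow 2)
    have h2 := ((hasDerivAt_id (0 : ℝ)).const_mul (4 * κ)).mul
      ((hasDerivAt_id (0 : ℝ)).add_const 1)
    refine (h1.sub h2).congr_deriv ?_
    simp
    ring
  have hs := hpoly.sqrt (by simp; positivity)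
  refine hs.congr_deriv ?_
  change _ / (2 * D κ nth 0) = _
  rw [D_zero hκ hnth]
  field_simp
  ring

open Filter Topology in
theorem tendsto_g_sub_g_div_atTop {S d : ℝ → ℝ} {S' α : ℝ} (hα0 : 0 < α) (hα1 : α < 1)
    (hd : HasDerivAt d α 0) (hd0 : d 0 = 0) (hS : HasDerivAt S S' 0) (hS0 : S 0 = 0) :
    Tendsto (fun n => (g n - g (d n) + S n) / n) (𝓝[>] 0) atTop := by
  have hdn := hd.tendsto_div_of_apply_zero hd0
  have hsmooth : DifferentiableAt ℝ
      (fun n => (n + 1) * Real.logb 2 (n + 1) - (d n + 1) * Real.logb 2 (d n + 1) + S n) 0 := by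
    have h1 := ((differentiableAt_id (𝕜 := ℝ) (x := (0 : ℝ))).add_const 1).mul_logb_self (by simp)
    have h2 := (hd.differentiableAt.add_const 1).mul_logb_self (by simp [hd0])
    exact (h1.sub h2).add hS.differentiableAt
  have hsn := hsmooth.hasDerivAt.tendsto_div_of_apply_zero (by simp [hd0, hS0])
  have hlog : Tendsto (fun n => -Real.logb 2 n) (𝓝[>] 0) atTop :=
    tendsto_neg_atBot_atTop.comp
      (Real.tendsto_log_nhdsGT_zero.atBot_div_const (Real.log_pos one_lt_two))
  have hmain := hlog.atTop_mul_pos (sub_pos.2 hα1) (hdn.const_sub 1)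
  have hratio : Tendsto (fun n => d n / n * Real.logb 2 (d n / n)) (𝓝[>] 0)
      (𝓝 (α * Real.logb 2 α)) :=
    (differentiableAt_id.mul_logb_self hα0.ne').continuousAt.tendsto.comp hdn
  refine (hmain.atTop_add (hsn.add hratio)).congr' ?_
  filter_upwards [self_mem_nhdsWithin, hdn.eventually (lt_mem_nhds hα0)] with n hn hpos
  have hn : 0 < n := hn
  have hd_pos : 0 < d n := (div_pos_iff_of_pos_right hn).1 hpos
  rw [Real.logb_div hd_pos.ne' hn.ne']
  simp only [g]
  field_simp
  ring

/-- The entanglement-assisted classical capacity per unit cost of the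
amplifier channel is infinite: `F n̄ / n̄ → +∞` as `n̄ → 0⁺`. -/
theorem amplifier_EA_capacity_per_unit_cost_infinite (κ nth : ℝ)
    (hκ : 1 < κ) (hnth : 0 < nth) :
    Filter.Tendsto (fun n : ℝ => F κ nth n / n)
      (nhdsWithin 0 (Set.Ioi 0)) Filter.atTop := by
  have hc : 0 < (κ - 1) * (nth + 1) := mul_pos (by linarith) (by linarith)
  have hD := hasDerivAt_D_zero hκ hnth
  have hD0 := D_zero hκ hnth
  have hlin : HasDerivAt (fun n => (κ - 1) * (n + nth + 1)) (κ - 1) 0 := by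
    simpa using
      (((hasDerivAt_id (0 : ℝ)).add_const nth).add_const 1).const_mul (κ - 1)
  have hminus : HasDerivAt (fun n => (D κ nth n - (κ - 1) * (n + nth + 1) - 1) / 2)
      (1 - κ / ((κ - 1) * (nth + 1) + 1)) 0 :=
    (((hD.sub hlin).sub_const 1).div_const 2).congr_deriv (by ring)
  have hplus : DifferentiableAt ℝ (fun n => (D κ nth n + (κ - 1) * (n + nth + 1) - 1) / 2) 0 :=
    (((hD.add hlin).sub_const 1).div_const 2).differentiableAt
  have hplus0 : (D κ nth 0 + (κ - 1) * (0 + nth + 1) - 1) / 2 = (κ - 1) * (nth + 1) := by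
    rw [hD0]
    ring
  have hS : DifferentiableAt ℝ (fun n => g (κ * n + (κ - 1) * (nth + 1))
      - g ((D κ nth n + (κ - 1) * (n + nth + 1) - 1) / 2)) 0 := by
    have h1 : DifferentiableAt ℝ (fun n => g (κ * n + (κ - 1) * (nth + 1))) 0 :=
      (differentiableAt_g (by simpa using hc)).comp (0 : ℝ)
        ((differentiableAt_id.const_mul κ).add_const _)
    have h2 : DifferentiableAt ℝ
        (fun n => g ((D κ nth n + (κ - 1) * (n + nth + 1) - 1) / 2)) 0 :=
      (differentiableAt_g (by rw [hplus0]; exact hc)).comp (0 : ℝ) hplus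
    exact h1.sub h2
  have hα0 : 0 < 1 - κ / ((κ - 1) * (nth + 1) + 1) := by
    rw [sub_pos, div_lt_one (by linarith)]
    nlinarith
  have hα1 : 1 - κ / ((κ - 1) * (nth + 1) + 1) < 1 :=
    sub_lt_self _ (div_pos (by linarith) (by linarith))
  refine (tendsto_g_sub_g_div_atTop hα0 hα1 hminus (by rw [hD0]; ring) hS.hasDerivAt
    (by simp only [hplus0]; simp)).congr fun n => ?_
  simp only [F]
  ring
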